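/- arXiv:2102.00474 — 2 statements merged into one kernel-verified Lean document; each statement's English description precedes it below -/
import Mathlib

section
/- There exists a self-dual binary linear code C ⊆ F₂^{72} whose minimum nonzero Hamming weight is 12, which contains exactly 468 codewords of Hamming weight 12 and exactly 7488 codewords of Hamming weight 14 (the weight enumerator W_{72,1} with γ = 18 and β = 234). -/
/-- A subspace `C` of `(ZMod 2)^ι` is self-dual if it equals its Euclidean dual. -/
def IsSelfDual {R : Type*} [CommRing R] {ι : Type*} [Fintype ι]
    (C : Submodule R (ι → R)) : Prop :=
  ∀ x, x ∈ C ↔ ∀ y ∈ C, ∑ i, x i * y i = 0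

/-- The Hamming weight of a vector: the number of nonzero coordinates. -/
def hamWt {ι : Type*} [Fintype ι] {R : Type*} [Zero R] [DecidableEq R] (v : ι → R) : ℕ :=
  (Finset.univ.filter fun i => v i ≠ 0).card

open scoped Matrix

/-- The rows of a four-circulant matrix of order 36; bit `j` of an entry is the coefficient in
column `j`. -/
def generatorRows : List ℕ :=
  [762053173, 1524106346, 3048212692, 6096425384, 12192850768, 24385701536, 48771403072,
   28823591552, 57647183104, 46574889473, 24430564354, 48861128708, 29003042824, 58005823505,
   47292170275, 25865125958, 51729989773, 34740764954, 23756985985, 47513709827, 26308205062,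
   52616147981, 36512819227, 4306423862, 8612585581, 17225171162, 34450080181, 180683627,
   361367254, 722472365, 1444944730, 2889889460, 5779778920, 11559557840, 23119115680,
   46238231360]

/-- The rows of the transpose of the matrix with rows `generatorRows`. -/
def transposeRows : List ℕ :=
  [762143233, 1524286466, 3048310789, 6096621578, 12192981013, 24385699883, 48771399766,
   28823584940, 57647169880, 46574863025, 24430511458, 48861022916, 29002831240, 58005662480,
   47292110368, 25865006144, 51730012288, 34740809984, 148297345, 296332547, 592665094,
   1185068045, 2369873947, 4739747894, 9479233645, 18958467290, 37916672437, 7113868139,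
   14227736278, 28455210413, 56910420826, 45101627060, 21484039528, 42968079056, 17216943520,
   34433887040]

/-- `pack w L` stores the entries of `L` in consecutive `w`-bit slots of one natural number. -/
def pack (w : ℕ) (L : List ℕ) : ℕ := L.foldr (fun x acc => x + 2 ^ w * acc) 0

/-- Sum of the shifted copies of `X`, masked in every slot by `mask`;
`ones` has a `1` in each slot. -/
def gather (ones mask : ℕ) (shifts : List ℕ) (X : ℕ) : ℕ :=
  (shifts.map fun s => (X >>> s) &&& (mask * ones)).sum

/-- Equal to `f n`; the recursor makes kernel reduction evaluate `n` before it is substituted. -/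
def forceNat {α : Type*} (n : ℕ) (f : ℕ → α) : α :=
  Nat.rec (motive := fun _ => α) (f 0) (fun m _ => f m.succ) n

/-- Replaces the content of every 36-bit slot of `X` by its binary weight. The masks select
every third bit, the lower halves of all 6-bit fields, the lowest 18 bits and the lowest 6 bits. -/
def slotWeights (ones X : ℕ) : ℕ :=
  forceNat (gather ones 9817068105 [0, 1, 2] X) fun X =>
  forceNat (gather ones 7635497415 [0, 3] X) fun X =>
  forceNat (gather ones 262143 [0, 18] X) fun X =>
  gather ones 63 [0, 6, 12] X

/-- The number of slots of `Y` with content `v`, when all slots of `Y` are below `64`. -/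
def countSlotsEq (ones v Y : ℕ) : ℕ :=
  gather ones 1 [6] ((Y ^^^ ((v ^^^ 63) * ones)) + ones) % (2 ^ 36 - 1)

/-- A list of 36-bit words packed into one natural number `data`, with `ones` marking the slots. -/
structure Block where
  len : ℕ
  ones : ℕ
  data : ℕ

/-- The block that stores a list of words. -/
def Block.ofList (L : List ℕ) : Block :=
  ⟨L.length, pack 36 (L.map fun _ => 1), pack 36 L⟩

/-- Concatenation of blocks. -/
def Block.append (b c : Block) : Block :=
  ⟨b.len + c.len, b.ones + c.ones <<< (36 * b.len), b.data + c.data <<< (36 * b.len)⟩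

/-- Adds the word `x` to every word of a block. -/
def Block.xor (b : Block) (x : ℕ) : Block :=
  ⟨b.len, b.ones, b.data ^^^ (x * b.ones)⟩

/-- Equal to `f b`, with the fields of `b` evaluated first. -/
def forceBlock {α : Type*} (b : Block) (f : Block → α) : α :=
  forceNat b.len fun l => forceNat b.ones fun o => forceNat b.data fun d => f ⟨l, o, d⟩

/-- Equal to `f bs`, with all blocks evaluated first. -/
def forceBlocks {α : Type*} : List Block → (List Block → α) → α
  | [], f => f []
  | b :: bs, f => forceBlock b fun b => forceBlocks bs fun bs => f (b :: bs)

/-- The sum of `m` times the number of words of weight `w`, over the pairs `(w, m)` in `spec`. -/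
def Block.count (b : Block) (spec : List (ℕ × ℕ)) : ℕ :=
  forceNat b.data fun X => forceNat (slotWeights b.ones X) fun Y =>
    (spec.map fun p => p.2 * countSlotsEq b.ones p.1 Y).sum

/-- Combines each block with the sums of `a` and the words of its predecessor. -/
def extendTail (a : ℕ) : Block → List Block → List Block
  | _, [] => []
  | b, c :: cs => c.append (b.xor a) :: extendTail a c cs

/-- Updates the blocks of `k`-fold sums when the word `a` joins the list of summands. -/
def extend (a : ℕ) : List Block → List Block
  | [] => []
  | b :: bs => b :: extendTail a b bs

/-- Tallies the weights of the sums of `k + 1` of the rows according to the `k`-th entry of `specs`,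
without storing the sums of more than five rows. -/
def scan (specs : List (List (ℕ × ℕ))) : List Block → List ℕ → ℕ
  | _, [] => 0
  | st, a :: todo =>
    (List.zipWith (fun b spec => (b.xor a).count spec) st specs).sum +
      forceBlocks (extend a st) fun st => scan specs st todo

/-- Tallies the weights of the sums of seven of the rows, two of which are treated separately. -/
def pairScan (spec : List (ℕ × ℕ)) : List Block → List ℕ → ℕ
  | _, [] => 0
  | st, a :: todo =>
    (todo.map fun b => ((st.getD 5 (Block.ofList [])).xor (a ^^^ b) |>.count spec)).sum +
      forceBlocks (extend a st) fun st => pairScan spec st todo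

/-- The weights that `scan` looks for: total weight 12 in the low 64 bits of the result, total
weight 14 in the next 64 bits, and the smaller total weights above. -/
def specs (c : ℕ) : List (List (ℕ × ℕ)) :=
  (List.range 5).map (fun k => ((List.range (11 - k)).map fun v => (v, 2 ^ 128)) ++
    [(11 - k, 1), (13 - k, 2 ^ 64)]) ++ [[(6, c), (8, 2 ^ 64)]]

/-- The blocks of `k`-fold sums of the empty list of rows. -/
def initBlocks : List Block := (List.range 6).map fun k => Block.ofList (if k = 0 then [0] else [])

lemma pack_cons (w x : ℕ) (L : List ℕ) : pack w (x :: L) = x + 2 ^ w * pack w L := rfl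

lemma pack_append (w : ℕ) (L L' : List ℕ) :
    pack w (L ++ L') = pack w L + pack w L' <<< (w * L.length) := by
  induction L with
  | nil => simp [pack]
  | cons x L ih =>
    rw [List.cons_append, pack_cons, pack_cons, ih, Nat.shiftLeft_eq, Nat.shiftLeft_eq,
      List.length_cons, Nat.mul_succ, pow_add]
    ring

lemma pack_add (w : ℕ) {α : Type*} (f g : α → ℕ) (L : List α) :
    pack w (L.map f) + pack w (L.map g) = pack w (L.map fun x => f x + g x) := by
  induction L with
  | nil => simp [pack]
  | cons x L ih =>
    simp only [List.map_cons, pack_cons, ← ih]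
    ring

lemma pack_modEq_sum (w : ℕ) (L : List ℕ) : pack w L ≡ L.sum [MOD 2 ^ w - 1] := by
  induction L with
  | nil => rfl
  | cons x L ih =>
    have h : 2 ^ w ≡ 1 [MOD 2 ^ w - 1] :=
      (Nat.modEq_iff_dvd' Nat.one_le_two_pow).2 dvd_rfl |>.symm
    simpa [pack_cons] using (h.mul ih).add_left x

lemma testBit_add_two_pow_mul {w x : ℕ} (hx : x < 2 ^ w) (a j : ℕ) :
    (x + 2 ^ w * a).testBit j = if j < w then x.testBit j else a.testBit (j - w) := by
  rw [add_comm, Nat.testBit_two_pow_mul_add a hx]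

lemma pack_xor {w x : ℕ} (hx : x < 2 ^ w) {L : List ℕ} (hL : ∀ y ∈ L, y < 2 ^ w) :
    pack w L ^^^ (x * pack w (L.map fun _ => 1)) = pack w (L.map (· ^^^ x)) := by
  induction L with
  | nil => simp [pack]
  | cons y L ih =>
    simp only [List.mem_cons, forall_eq_or_imp] at hL
    rw [List.map_cons, List.map_cons, pack_cons, pack_cons, pack_cons, ← ih hL.2, mul_add, mul_one,
      mul_left_comm]
    refine Nat.eq_of_testBit_eq fun j => ?_
    rw [Nat.testBit_xor, testBit_add_two_pow_mul hL.1, testBit_add_two_pow_mul hx,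
      testBit_add_two_pow_mul (Nat.xor_lt_two_pow hL.1 hx)]
    split <;> simp

lemma pack_shiftRight_and {w s m : ℕ} (hm : m < 2 ^ (w - s)) {L : List ℕ}
    (hL : ∀ y ∈ L, y < 2 ^ w) :
    (pack w L >>> s) &&& (m * pack w (L.map fun _ => 1)) =
      pack w (L.map fun y => (y >>> s) &&& m) := by
  have hmw : m < 2 ^ w := hm.trans_le (Nat.pow_le_pow_right two_pos (Nat.sub_le _ _))
  induction L with
  | nil => simp [pack]
  | cons y L ih =>
    simp only [List.mem_cons, forall_eq_or_imp] at hL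
    rw [List.map_cons, List.map_cons, pack_cons, pack_cons, pack_cons, ← ih hL.2, mul_add, mul_one,
      mul_left_comm]
    refine Nat.eq_of_testBit_eq fun j => ?_
    rw [Nat.testBit_and, Nat.testBit_shiftRight, testBit_add_two_pow_mul hL.1,
      testBit_add_two_pow_mul hmw,
      testBit_add_two_pow_mul (Nat.and_lt_two_pow _ hmw), Nat.testBit_and, Nat.testBit_and,
      Nat.testBit_shiftRight, Nat.testBit_shiftRight]
    by_cases hj : j < w
    · by_cases hsj : s + j < w
      · simp [hj, hsj]
      · have : m.testBit j = false :=
          Nat.testBit_lt_two_pow (hm.trans_le (Nat.pow_le_pow_right two_pos (by omega)))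
        simp [this, hj]
    · have hsj : ¬ s + j < w := by omega
      simp [hj, hsj, Nat.add_sub_assoc (not_lt.1 hj)]

lemma pack_map_zero (w : ℕ) {α : Type*} (L : List α) : pack w (L.map fun _ => 0) = 0 := by
  induction L with
  | nil => rfl
  | cons y L ih => rw [List.map_cons, pack_cons, ih]; rfl

lemma gather_cons (ones m s : ℕ) (shifts : List ℕ) (y : ℕ) :
    gather ones m (s :: shifts) y = ((y >>> s) &&& (m * ones)) + gather ones m shifts y := rfl

lemma gather_pack {w m : ℕ} {shifts : List ℕ} (hm : ∀ s ∈ shifts, m < 2 ^ (w - s)) {L : List ℕ}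
    (hL : ∀ y ∈ L, y < 2 ^ w) :
    gather (pack w (L.map fun _ => 1)) m shifts (pack w L) =
      pack w (L.map (gather 1 m shifts)) := by
  induction shifts with
  | nil => exact (pack_map_zero w L).symm
  | cons s shifts ih =>
    simp only [List.mem_cons, forall_eq_or_imp] at hm
    rw [gather_cons, ih hm.2, pack_shiftRight_and hm.1 hL, pack_add]
    exact congrArg _ (List.map_congr_left fun y _ => by rw [gather_cons, mul_one])

lemma gather_one_le (m : ℕ) (shifts : List ℕ) (y : ℕ) :
    gather 1 m shifts y ≤ shifts.length * m := by
  induction shifts with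
  | nil => simp [gather]
  | cons s shifts ih =>
    simp only [gather, List.map_cons, List.sum_cons, mul_one, List.length_cons] at ih ⊢
    have : (y >>> s) &&& m ≤ m := Nat.and_le_right
    linarith

lemma forceNat_eq {α : Type*} (n : ℕ) (f : ℕ → α) : forceNat n f = f n := by
  cases n <;> rfl

lemma forceBlock_eq {α : Type*} (b : Block) (f : Block → α) : forceBlock b f = f b := by
  simp [forceBlock, forceNat_eq]

lemma forceBlocks_eq {α : Type*} (bs : List Block) (f : List Block → α) :
    forceBlocks bs f = f bs := by
  induction bs generalizing f with
  | nil => rfl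
  | cons b bs ih => simp [forceBlocks, forceBlock_eq, ih]

lemma slotWeights_pack {L : List ℕ} (hL : ∀ y ∈ L, y < 2 ^ 36) :
    slotWeights (pack 36 (L.map fun _ => 1)) (pack 36 L) = pack 36 (L.map (slotWeights 1)) := by
  have key : ∀ {m : ℕ} {shifts : List ℕ} (f : ℕ → ℕ), (∀ s ∈ shifts, m < 2 ^ (36 - s)) →
      (∀ y, y ∈ L → f y < 2 ^ 36) →
      gather (pack 36 (L.map fun _ => 1)) m shifts (pack 36 (L.map f)) =
        pack 36 (L.map fun y => gather 1 m shifts (f y)) := fun f hm hf => by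
    have h := gather_pack hm (L := L.map f) (by simpa using hf)
    simpa only [List.map_map, Function.comp_def] using h
  have bound : ∀ (m : ℕ) (shifts : List ℕ) (y : ℕ), shifts.length * m < 2 ^ 36 →
      gather 1 m shifts y < 2 ^ 36 := fun m shifts y => (gather_one_le m shifts y).trans_lt
  have hid : pack 36 L = pack 36 (L.map fun y => y) := by simp
  have hone : slotWeights 1 = fun y => gather 1 63 [0, 6, 12] (gather 1 262143 [0, 18]
      (gather 1 7635497415 [0, 3] (gather 1 9817068105 [0, 1, 2] y))) := by
    funext y
    simp only [slotWeights, forceNat_eq]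
  rw [hone]
  simp only [slotWeights, forceNat_eq]
  rw [hid, key _ (by decide) hL, key _ (by decide) fun y _ => bound _ _ _ (by decide),
    key _ (by decide) fun y _ => bound _ _ _ (by decide),
    key _ (by decide) fun y _ => bound _ _ _ (by decide)]

/-- The number of nonzero bits among the lowest 36. -/
def bitWeight (y : ℕ) : ℕ := ∑ i ∈ Finset.range 36, (y.testBit i).toNat

lemma exists_pack_eq (w : ℕ) {n y : ℕ} (hy : y < 2 ^ (w * n)) :
    ∃ L : List ℕ, L.length = n ∧ (∀ x ∈ L, x < 2 ^ w) ∧ pack w L = y := by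
  induction n generalizing y with
  | zero => exact ⟨[], rfl, by simp, by simpa [pack, eq_comm] using hy⟩
  | succ n ih =>
    obtain ⟨L, hn, hL, h⟩ := @ih (y / 2 ^ w) (by
      rwa [Nat.div_lt_iff_lt_mul (by positivity), ← pow_add, ← Nat.mul_succ])
    refine ⟨y % 2 ^ w :: L, by simp [hn], ?_, by rw [pack_cons, h, Nat.mod_add_div]⟩
    simp only [List.mem_cons, forall_eq_or_imp]
    exact ⟨Nat.mod_lt _ (by positivity), hL⟩

lemma sum_testBit_pack {w : ℕ} {L : List ℕ} (hL : ∀ x ∈ L, x < 2 ^ w) :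
    ∑ i ∈ Finset.range (w * L.length), ((pack w L).testBit i).toNat =
      (L.map fun x => ∑ i ∈ Finset.range w, (x.testBit i).toNat).sum := by
  induction L with
  | nil => simp
  | cons x L ih =>
    simp only [List.mem_cons, forall_eq_or_imp] at hL
    rw [List.length_cons, Nat.mul_succ, add_comm, Finset.sum_range_add, List.map_cons,
      List.sum_cons, ← ih hL.2, pack_cons]
    congr 1 <;> refine Finset.sum_congr rfl fun i hi => ?_ <;>
      rw [testBit_add_two_pow_mul hL.1]
    · rw [if_pos (Finset.mem_range.1 hi)]
    · simp

lemma gather_pack_six {L : List ℕ} (hn : L.length = 6) (hL : ∀ x ∈ L, x ≤ 6) :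
    gather 1 63 [0, 6, 12] (gather 1 262143 [0, 18] (pack 6 L)) = L.sum := by
  match L, hn with
  | [a, b, c, d, e, f], _ =>
    simp only [List.mem_cons, forall_eq_or_imp, List.not_mem_nil, false_imp_iff,
      implies_true, and_true] at hL
    have h₁ (x : ℕ) : x &&& 63 = x % 64 := Nat.and_two_pow_sub_one_eq_mod x 6
    have h₂ (x : ℕ) : x &&& 262143 = x % 262144 := Nat.and_two_pow_sub_one_eq_mod x 18
    have hlow : pack 6 [a, b, c, d, e, f] % 262144 = a + 64 * b + 4096 * c := by
      simp [pack]
      omega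
    have hhigh : pack 6 [a, b, c, d, e, f] / 262144 = d + 64 * e + 4096 * f := by
      simp [pack]
      omega
    have h : gather 1 262143 [0, 18] (pack 6 [a, b, c, d, e, f]) =
        (a + d) + 64 * (b + e) + 4096 * (c + f) := by
      simp [gather, Nat.shiftRight_eq_div_pow, h₂, hlow, hhigh]
      omega
    clear hlow hhigh
    have hmid : ((a + d) + 64 * (b + e) + 4096 * (c + f)) / 64 = (b + e) + 64 * (c + f) := by omega
    have htop : ((a + d) + 64 * (b + e) + 4096 * (c + f)) / 4096 = c + f := by omega
    rw [h]
    simp [gather, Nat.shiftRight_eq_div_pow, h₁, hmid, htop]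
    omega

lemma slotWeights_one {y : ℕ} (hy : y < 2 ^ 36) : slotWeights 1 y = bitWeight y := by
  obtain ⟨L, hn, hL, rfl⟩ := exists_pack_eq 6 (n := 6) (by simpa using hy)
  have hones : pack 6 (L.map fun _ => 1) = 1090785345 := by
    match L, hn with
    | [a, b, c, d, e, f], _ => simp [pack]
  let pairs (x : ℕ) : ℕ := gather 1 7 [0, 3] (gather 1 9 [0, 1, 2] x)
  have h₁ : gather 1 9817068105 [0, 1, 2] (pack 6 L) =
      pack 6 (L.map (gather 1 9 [0, 1, 2])) := by
    rw [← gather_pack (by decide) hL, hones]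
    rfl
  have h₂ : gather 1 7635497415 [0, 3] (pack 6 (L.map (gather 1 9 [0, 1, 2]))) =
      pack 6 (L.map pairs) := by
    have h := gather_pack (w := 6) (m := 7) (shifts := [0, 3])
      (L := L.map (gather 1 9 [0, 1, 2])) (by decide) (by
        simpa using fun x _ => (gather_one_le _ _ _).trans_lt (by decide))
    rw [List.map_map, List.map_map, Function.comp_def, hones] at h
    exact h
  have hpairs : ∀ x < 2 ^ 6, pairs x = ∑ i ∈ Finset.range 6, (x.testBit i).toNat ∧ pairs x ≤ 6 := by
    decide
  rw [slotWeights, forceNat_eq, h₁, forceNat_eq, h₂, forceNat_eq,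
    gather_pack_six (by simpa using hn) (by simpa using fun x hx => (hpairs x (hL x hx)).2),
    bitWeight, show 36 = 6 * L.length by rw [hn], sum_testBit_pack hL]
  exact congrArg List.sum (List.map_congr_left fun x hx => (hpairs x (hL x hx)).1)

lemma bitWeight_lt (y : ℕ) : bitWeight y < 64 := by
  have : bitWeight y ≤ ∑ i ∈ Finset.range 36, 1 :=
    Finset.sum_le_sum fun i _ => Bool.toNat_le _
  simp at this
  omega

lemma sum_map_ite_eq_countP {α : Type*} (p : α → Prop) [DecidablePred p] (L : List α) :
    (L.map fun x => if p x then 1 else 0).sum = L.countP p := by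
  induction L with
  | nil => rfl
  | cons x L ih => simp [List.countP_cons, ih, add_comm]

lemma countSlotsEq_pack {v : ℕ} (hv : v < 64) {L : List ℕ} (hL : ∀ c ∈ L, c < 64)
    (hlen : L.length < 2 ^ 36 - 1) :
    countSlotsEq (pack 36 (L.map fun _ => 1)) v (pack 36 L) = L.countP (· = v) := by
  have hslot : ∀ c < 64, gather 1 1 [6] ((c ^^^ (v ^^^ 63)) + 1) = if c = v then 1 else 0 := by
    intro c hc
    have hz : ∀ z < 2 ^ 6, gather 1 1 [6] (z + 1) = if z = 63 then 1 else 0 := by decide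
    have hiff : c ^^^ v ^^^ 63 = 63 ↔ c = v :=
      ⟨fun h => Nat.eq_of_xor_eq_zero (Nat.xor_left_inj.1 (h.trans (Nat.zero_xor 63).symm)),
        by rintro rfl; rw [Nat.xor_self, Nat.zero_xor]⟩
    rw [← Nat.xor_assoc,
      hz _ (Nat.xor_lt_two_pow (Nat.xor_lt_two_pow hc hv) (by norm_num)), if_congr hiff rfl rfl]
  have hv' : v ^^^ 63 < 2 ^ 6 := Nat.xor_lt_two_pow hv (by norm_num)
  have hL' : ∀ c ∈ L, c ^^^ (v ^^^ 63) < 2 ^ 6 := fun c hc => Nat.xor_lt_two_pow (hL c hc) hv'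
  have h := gather_pack (w := 36) (m := 1) (shifts := [6])
    (L := L.map fun c => (c ^^^ (v ^^^ 63)) + 1) (by decide) (by
      simp only [List.mem_map, forall_exists_index, and_imp, forall_apply_eq_imp_iff₂]
      intro c hc
      have := hL' c hc
      omega)
  rw [List.map_map, List.map_map, Function.comp_def, Function.comp_def] at h
  rw [countSlotsEq, pack_xor (hv'.trans (by norm_num)) fun c hc => (hL c hc).trans (by norm_num),
    pack_add, h, pack_modEq_sum, List.map_congr_left fun c hc => hslot c (hL c hc)]
  rw [sum_map_ite_eq_countP]
  exact Nat.mod_eq_of_lt (List.countP_le_length.trans_lt hlen)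

/-- The specification of `Block.count`. -/
def tally (spec : List (ℕ × ℕ)) (L : List ℕ) : ℕ :=
  (spec.map fun p => p.2 * L.countP fun y => bitWeight y = p.1).sum

lemma tally_append (spec : List (ℕ × ℕ)) (L L' : List ℕ) :
    tally spec (L ++ L') = tally spec L + tally spec L' := by
  simp only [tally, List.countP_append, mul_add, List.sum_map_add]

lemma Block.count_ofList {spec : List (ℕ × ℕ)} (hspec : ∀ p ∈ spec, p.1 < 64) {L : List ℕ}
    (hL : ∀ y ∈ L, y < 2 ^ 36) (hlen : L.length < 2 ^ 36 - 1) :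
    (Block.ofList L).count spec = tally spec L := by
  have hw : L.map (slotWeights 1) = L.map bitWeight :=
    List.map_congr_left fun y hy => slotWeights_one (hL y hy)
  have hones : L.map (fun _ => 1) = (L.map bitWeight).map fun _ => 1 := by
    rw [List.map_map, Function.comp_def]
  have hlt : ∀ c ∈ L.map bitWeight, c < 64 := by
    simp only [List.mem_map]
    rintro _ ⟨y, -, rfl⟩
    exact bitWeight_lt y
  simp only [Block.count, forceNat_eq, Block.ofList, slotWeights_pack hL, hw, tally]
  refine congrArg List.sum (List.map_congr_left fun p hp => ?_)
  rw [hones, countSlotsEq_pack (hspec p hp) hlt (by rwa [List.length_map]), List.countP_map,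
    Function.comp_def]

lemma Block.append_ofList (L L' : List ℕ) :
    (Block.ofList L).append (Block.ofList L') = Block.ofList (L ++ L') := by
  simp only [Block.append, Block.ofList, List.map_append, pack_append, List.length_append,
    List.length_map]

lemma Block.xor_ofList {x : ℕ} (hx : x < 2 ^ 36) {L : List ℕ} (hL : ∀ y ∈ L, y < 2 ^ 36) :
    (Block.ofList L).xor x = Block.ofList (L.map (x ^^^ ·)) := by
  simp only [Block.xor, Block.ofList, pack_xor hx hL, List.map_map, List.length_map,
    Function.comp_def, Nat.xor_comm x]

/-- The sum of a list of words over `ZMod 2`. -/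
def xorSum (l : List ℕ) : ℕ := l.foldr (· ^^^ ·) 0

/-- The sums of `k` entries of `l`. -/
def combos (k : ℕ) (l : List ℕ) : List ℕ := (l.sublistsLen k).map xorSum

lemma combos_zero (l : List ℕ) : combos 0 l = [0] := by simp [combos, xorSum]

lemma combos_succ_nil (k : ℕ) : combos (k + 1) [] = [] := by simp [combos]

lemma combos_succ_cons (k a : ℕ) (l : List ℕ) :
    combos (k + 1) (a :: l) = combos (k + 1) l ++ (combos k l).map (a ^^^ ·) := by
  simp [combos, List.sublistsLen_succ_cons, xorSum, Function.comp_def]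

lemma length_combos (k : ℕ) (l : List ℕ) : (combos k l).length = l.length.choose k := by
  simp [combos, List.length_sublistsLen]

lemma lt_of_mem_combos {w k : ℕ} {l : List ℕ} (hl : ∀ a ∈ l, a < 2 ^ w) :
    ∀ y ∈ combos k l, y < 2 ^ w := by
  induction l generalizing k with
  | nil => cases k <;> simp [combos_zero, combos_succ_nil]
  | cons a l ih =>
    simp only [List.mem_cons, forall_eq_or_imp] at hl
    cases k with
    | zero => simp [combos_zero]
    | succ k =>
      simp only [combos_succ_cons, List.mem_append, List.mem_map]
      rintro y (hy | ⟨z, hz, rfl⟩)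
      · exact ih hl.2 y hy
      · exact Nat.xor_lt_two_pow hl.1 (ih hl.2 z hz)

/-- The blocks of `k`-fold sums of `l` for `k < 6`. -/
def comboBlocks (l : List ℕ) : List Block := (List.range 6).map fun k => Block.ofList (combos k l)

lemma comboBlocks_nil : comboBlocks [] = initBlocks := by
  simp [comboBlocks, initBlocks, List.range_succ, combos_zero, combos_succ_nil]

lemma extend_comboBlocks {a : ℕ} (ha : a < 2 ^ 36) {l : List ℕ} (hl : ∀ b ∈ l, b < 2 ^ 36) :
    extend a (comboBlocks l) = comboBlocks (a :: l) := by
  have h (k : ℕ) : (Block.ofList (combos (k + 1) l)).append ((Block.ofList (combos k l)).xor a) =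
      Block.ofList (combos (k + 1) (a :: l)) := by
    rw [Block.xor_ofList ha (lt_of_mem_combos hl), Block.append_ofList, combos_succ_cons]
  simp only [comboBlocks, List.range_succ_eq_map, List.range_zero, List.map_cons, List.map_nil,
    extend, extendTail, combos_zero]
  rw [← combos_zero l]
  simp [h]

lemma count_xor_comboBlock {spec : List (ℕ × ℕ)} (hspec : ∀ p ∈ spec, p.1 < 64) {a k : ℕ}
    (ha : a < 2 ^ 36) {l : List ℕ} (hl : ∀ b ∈ l, b < 2 ^ 36) (hlen : l.length < 36) :
    ((Block.ofList (combos k l)).xor a).count spec = tally spec ((combos k l).map (a ^^^ ·)) := by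
  rw [Block.xor_ofList ha (lt_of_mem_combos hl), Block.count_ofList hspec]
  · simp only [List.mem_map]
    rintro y ⟨z, hz, rfl⟩
    exact Nat.xor_lt_two_pow ha (lt_of_mem_combos hl z hz)
  · rw [List.length_map, length_combos]
    calc l.length.choose k ≤ 2 ^ l.length := Nat.choose_le_two_pow _ _
      _ ≤ 2 ^ 35 := Nat.pow_le_pow_right two_pos (by omega)
      _ < 2 ^ 36 - 1 := by norm_num

lemma scan_comboBlocks {ss : List (List (ℕ × ℕ))} (hlen : ss.length = 6)
    (hss : ∀ spec ∈ ss, ∀ p ∈ spec, p.1 < 64) {todo l : List ℕ} (htodo : ∀ b ∈ todo, b < 2 ^ 36)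
    (hl : ∀ b ∈ l, b < 2 ^ 36) (hn : todo.length + l.length ≤ 36) :
    (ss.mapIdx fun k spec => tally spec (combos (k + 1) l)).sum + scan ss (comboBlocks l) todo =
      (ss.mapIdx fun k spec => tally spec (combos (k + 1) (todo.reverse ++ l))).sum := by
  induction todo generalizing l with
  | nil => simp [scan]
  | cons a todo ih =>
    simp only [List.mem_cons, forall_eq_or_imp, List.length_cons] at htodo hn
    have hal : ∀ b ∈ a :: l, b < 2 ^ 36 := by simpa using ⟨htodo.1, hl⟩
    rw [List.reverse_cons, List.append_assoc, List.singleton_append,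
      ← ih htodo.2 hal (by simp; omega), scan, forceBlocks_eq, extend_comboBlocks htodo.1 hl,
      ← add_assoc]
    congr 1
    match ss, hlen with
    | [s₀, s₁, s₂, s₃, s₄, s₅], _ =>
      simp only [List.mem_cons, forall_eq_or_imp, List.not_mem_nil, false_imp_iff,
        implies_true, and_true] at hss
      obtain ⟨h₀, h₁, h₂, h₃, h₄, h₅⟩ := hss
      have hc {spec : List (ℕ × ℕ)} (hspec : ∀ p ∈ spec, p.1 < 64) (k : ℕ) :=
        count_xor_comboBlock hspec (k := k) htodo.1 hl (by omega)
      simp [comboBlocks, List.range_succ, combos_succ_cons, tally_append, hc h₀, hc h₁,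
        hc h₂, hc h₃, hc h₄, hc h₅]
      ring

lemma pairScan_comboBlocks {spec : List (ℕ × ℕ)} (hspec : ∀ p ∈ spec, p.1 < 64)
    {todo l : List ℕ} (htodo : ∀ b ∈ todo, b < 2 ^ 36) (hl : ∀ b ∈ l, b < 2 ^ 36)
    (hn : todo.length + l.length ≤ 36) :
    tally spec (combos 7 l) + (todo.map fun b => tally spec ((combos 6 l).map (b ^^^ ·))).sum +
        pairScan spec (comboBlocks l) todo =
      tally spec (combos 7 (todo.reverse ++ l)) := by
  induction todo generalizing l with
  | nil => simp [pairScan]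
  | cons a todo ih =>
    simp only [List.mem_cons, forall_eq_or_imp, List.length_cons] at htodo hn
    have hal : ∀ b ∈ a :: l, b < 2 ^ 36 := by simpa using ⟨htodo.1, hl⟩
    have hblock : (comboBlocks l).getD 5 (Block.ofList []) = Block.ofList (combos 5 l) := by
      simp [comboBlocks, List.range_succ]
    have hpair : (todo.map fun b => ((Block.ofList (combos 5 l)).xor (a ^^^ b)).count spec) =
        todo.map fun b => tally spec (((combos 5 l).map (a ^^^ ·)).map (b ^^^ ·)) :=
      List.map_congr_left fun b hb => by
        rw [count_xor_comboBlock hspec (Nat.xor_lt_two_pow htodo.1 (htodo.2 b hb)) hl (by omega),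
          List.map_map]
        simp only [Function.comp_def, Nat.xor_comm a b, Nat.xor_assoc]
    rw [List.reverse_cons, List.append_assoc, List.singleton_append,
      ← ih htodo.2 hal (by simp; omega), pairScan, forceBlocks_eq, extend_comboBlocks htodo.1 hl,
      hblock, hpair]
    simp only [combos_succ_cons, tally_append, List.map_append, List.map_cons, List.sum_cons,
      List.sum_map_add]
    ring

/-- The vector of the lowest `n` bits of `y`. -/
def bitVec {n : ℕ} (y : ℕ) : Fin n → ZMod 2 := fun j => if y.testBit j then 1 else 0

lemma bitVec_zero {n : ℕ} : (bitVec 0 : Fin n → ZMod 2) = 0 := by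
  funext j
  simp [bitVec]

lemma bitVec_xor {n : ℕ} (x y : ℕ) : (bitVec (x ^^^ y) : Fin n → ZMod 2) = bitVec x + bitVec y := by
  funext j
  simp only [bitVec, Nat.testBit_xor, Pi.add_apply]
  cases x.testBit j <;> cases y.testBit j <;> decide

lemma hamWt_bitVec (y : ℕ) : hamWt (bitVec y : Fin 36 → ZMod 2) = bitWeight y := by
  rw [hamWt, Finset.card_filter, bitWeight, Finset.sum_range]
  refine Finset.sum_congr rfl fun j _ => ?_
  cases h : y.testBit j <;> simp [bitVec, h]

lemma bitVec_xorSum {n : ℕ} (l : List ℕ) :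
    (bitVec (xorSum l) : Fin n → ZMod 2) = (l.map bitVec).sum := by
  induction l with
  | nil => exact bitVec_zero
  | cons a l ih => rw [xorSum, List.foldr_cons, bitVec_xor, List.map_cons, List.sum_cons, ← ih]; rfl

/-- The matrix whose rows are given by bit strings. -/
def rowMatrix (n : ℕ) (rows : List ℕ) : Matrix (Fin n) (Fin n) (ZMod 2) :=
  Matrix.of fun i => bitVec (rows.getD i 0)

/-- The number of codewords `(u, u ᵥ* M)` whose two halves have weights `k` and `j`. -/
def wtCount {n : ℕ} (M : Matrix (Fin n) (Fin n) (ZMod 2)) (k j : ℕ) : ℕ :=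
  (Finset.univ.filter fun u : Fin n → ZMod 2 => hamWt u = k ∧ hamWt (u ᵥ* M) = j).card

lemma eq_zero_of_hamWt_eq_zero {ι : Type*} [Fintype ι] {u : ι → ZMod 2} (h : hamWt u = 0) :
    u = 0 := by
  simpa [hamWt, Finset.filter_eq_empty_iff, funext_iff] using h

lemma card_filter_powersetCard {n : ℕ} (M : Matrix (Fin n) (Fin n) (ZMod 2)) (k j : ℕ) :
    (((Finset.univ : Finset (Fin n)).powersetCard k).filter fun S =>
      hamWt (∑ i ∈ S, M.row i) = j).card = wtCount M k j := by
  have hsum (u : Fin n → ZMod 2) : u ᵥ* M = ∑ i with u i ≠ 0, M.row i := by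
    rw [Matrix.vecMul_eq_sum, Finset.sum_filter]
    refine Finset.sum_congr rfl fun i _ => ?_
    have : ∀ a : ZMod 2, a = 0 ∨ a = 1 := by decide
    rcases this (u i) with h | h <;> simp [h, Matrix.row]
  symm
  refine Finset.card_bij (fun u _ => Finset.univ.filter fun i => u i ≠ 0) ?_ ?_ ?_
  · intro u hu
    simpa [hsum, Finset.mem_powersetCard, hamWt] using hu
  · intro u _ v _ huv
    funext i
    have h : u i ≠ 0 ↔ v i ≠ 0 := by simpa using Finset.ext_iff.1 huv i
    revert h
    generalize u i = a
    generalize v i = b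
    revert a b
    decide
  · intro S hS
    have hS' : (Finset.univ.filter fun i => (if i ∈ S then (1 : ZMod 2) else 0) ≠ 0) = S := by
      ext i
      simp
    refine ⟨fun i => if i ∈ S then 1 else 0, ?_, hS'⟩
    rw [Finset.mem_filter, Finset.mem_powersetCard] at hS
    rw [Finset.mem_filter, hsum, hS', hamWt, hS']
    exact ⟨Finset.mem_univ _, hS.1.2, hS.2⟩

lemma coe_reverse_eq_map_univ {n : ℕ} {rows : List ℕ} (hn : rows.length = n) :
    (rows.reverse : Multiset ℕ) = Finset.univ.val.map fun i : Fin n => rows.getD i 0 := by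
  subst hn
  rw [Multiset.coe_reverse, Fin.univ_val_map]
  simp

lemma countP_sublistsLen {n : ℕ} {rows : List ℕ} (hn : rows.length = n) (k j : ℕ) :
    (rows.reverse.sublistsLen k).countP (fun l =>
      hamWt ((l.map bitVec).sum : Fin n → ZMod 2) = j) = wtCount (rowMatrix n rows) k j := by
  have h : (rows.reverse.sublistsLen k).countP (fun l =>
      hamWt ((l.map bitVec).sum : Fin n → ZMod 2) = j) =
      (Multiset.powersetCard k (rows.reverse : Multiset ℕ)).countP
        (fun s => hamWt ((s.map bitVec).sum : Fin n → ZMod 2) = j) := by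
    rw [Multiset.powersetCard_coe, Multiset.coe_countP, List.countP_map]
    rfl
  rw [h, coe_reverse_eq_map_univ hn, Multiset.powersetCard_map, ← Finset.map_val_val_powersetCard,
    ← card_filter_powersetCard, Multiset.map_map, Multiset.countP_map, Finset.card_def,
    Finset.filter_val]
  simp only [Function.comp_def, Multiset.map_map]
  rfl

lemma countP_combos {rows : List ℕ} (hn : rows.length = 36) (k j : ℕ) :
    (combos k rows.reverse).countP (fun y => bitWeight y = j) =
      wtCount (rowMatrix 36 rows) k j := by
  rw [← countP_sublistsLen hn, combos, List.countP_map]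
  simp only [Function.comp_def, ← hamWt_bitVec, bitVec_xorSum]

lemma tally_combos {rows : List ℕ} (hn : rows.length = 36) (spec : List (ℕ × ℕ)) (k : ℕ) :
    tally spec (combos k rows.reverse) =
      (spec.map fun p => p.2 * wtCount (rowMatrix 36 rows) k p.1).sum := by
  simp only [tally, countP_combos hn]

lemma wtCount_le {n : ℕ} (M : Matrix (Fin n) (Fin n) (ZMod 2)) (k j : ℕ) : wtCount M k j ≤ 2 ^ n :=
  (Finset.card_le_univ _).trans_eq (by simp)

lemma wtCount_transpose {n : ℕ} {M : Matrix (Fin n) (Fin n) (ZMod 2)} (hM : M * M.transpose = 1)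
    (k j : ℕ) : wtCount M.transpose k j = wtCount M j k := by
  have hM' : M.transpose * M = 1 := mul_eq_one_comm.1 hM
  refine Finset.card_bij' (fun u _ => u ᵥ* M.transpose) (fun u _ => u ᵥ* M) ?_ ?_ ?_ ?_ <;>
    simp +contextual [Matrix.vecMul_vecMul, hM, hM']

lemma scan_eq {rows : List ℕ} (hn : rows.length = 36) (hrows : ∀ a ∈ rows, a < 2 ^ 36) (c : ℕ) :
    scan (specs c) initBlocks rows =
      ((∑ k ∈ Finset.range 5, wtCount (rowMatrix 36 rows) (k + 1) (11 - k)) +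
        c * wtCount (rowMatrix 36 rows) 6 6) +
      2 ^ 64 * (∑ k ∈ Finset.range 6, wtCount (rowMatrix 36 rows) (k + 1) (13 - k)) +
      2 ^ 128 * ∑ k ∈ Finset.range 5, ∑ j ∈ Finset.range (11 - k),
        wtCount (rowMatrix 36 rows) (k + 1) j := by
  have h := scan_comboBlocks (ss := specs c) (todo := rows) (l := []) rfl (by
    simp only [specs, List.mem_append, List.mem_map, List.mem_range, List.mem_cons,
      List.not_mem_nil, or_false]
    rintro _ (⟨k, hk, rfl⟩ | rfl) p hp
    · simp only [List.mem_append, List.mem_map, List.mem_range, List.mem_cons, List.not_mem_nil,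
        or_false] at hp
      obtain ⟨v, hv, rfl⟩ | rfl | rfl := hp <;> dsimp only <;> omega
    · simp only [List.mem_cons, List.not_mem_nil, or_false] at hp
      obtain rfl | rfl := hp <;> norm_num) hrows (by simp) (by simp [hn])
  rw [comboBlocks_nil, List.append_nil] at h
  have h₀ : ((specs c).mapIdx fun k spec => tally spec (combos (k + 1) [])).sum = 0 := by
    simp [combos_succ_nil, tally, specs, List.range_succ]
  rw [h₀, zero_add] at h
  rw [h]
  simp [tally_combos hn, specs, List.range_succ, Finset.sum_range_succ]
  ring

lemma pairScan_eq {rows : List ℕ} (hn : rows.length = 36) (hrows : ∀ a ∈ rows, a < 2 ^ 36) :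
    pairScan [(7, 1)] initBlocks rows = wtCount (rowMatrix 36 rows) 7 7 := by
  have h := pairScan_comboBlocks (spec := [(7, 1)]) (todo := rows) (l := []) (by simp) hrows
    (by simp) (by simp [hn])
  rw [comboBlocks_nil, List.append_nil, tally_combos hn] at h
  simpa [combos_succ_nil, tally] using h

lemma append_inj_iff {n : ℕ} {u v u' v' : Fin n → ZMod 2} :
    Fin.append u v = Fin.append u' v' ↔ u = u' ∧ v = v' := by
  refine ⟨fun h => ⟨funext fun i => ?_, funext fun i => ?_⟩, by rintro ⟨rfl, rfl⟩; rfl⟩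
  · simpa only [Fin.append_left] using congrFun h (Fin.castAdd n i)
  · simpa only [Fin.append_right] using congrFun h (Fin.natAdd n i)

/-- The code of all vectors `(u, u ᵥ* M)`. -/
def rowCode {n : ℕ} (M : Matrix (Fin n) (Fin n) (ZMod 2)) :
    Submodule (ZMod 2) (Fin (n + n) → ZMod 2) where
  carrier := {v | ∃ u, v = Fin.append u (u ᵥ* M)}
  zero_mem' := ⟨0, by
    rw [Matrix.zero_vecMul]
    exact funext (Fin.addCases (fun i => by simp) (fun i => by simp [-Fin.natAdd_eq_addNat]))⟩
  add_mem' := by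
    rintro _ _ ⟨u, rfl⟩ ⟨v, rfl⟩
    refine ⟨u + v, ?_⟩
    rw [Matrix.add_vecMul]
    exact funext (Fin.addCases (fun i => by simp) (fun i => by simp [-Fin.natAdd_eq_addNat]))
  smul_mem' := by
    rintro c _ ⟨u, rfl⟩
    refine ⟨c • u, ?_⟩
    rw [Matrix.smul_vecMul]
    exact funext (Fin.addCases (fun i => by simp) (fun i => by simp [-Fin.natAdd_eq_addNat]))

lemma mem_rowCode {n : ℕ} {M : Matrix (Fin n) (Fin n) (ZMod 2)} {v : Fin (n + n) → ZMod 2} :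
    v ∈ rowCode M ↔ ∃ u, v = Fin.append u (u ᵥ* M) := Iff.rfl

lemma isSelfDual_rowCode {n : ℕ} {M : Matrix (Fin n) (Fin n) (ZMod 2)}
    (hM : M * M.transpose = 1) : IsSelfDual (rowCode M) := by
  intro x
  obtain ⟨a, b, rfl⟩ : ∃ a b : Fin n → ZMod 2, x = Fin.append a b :=
    ⟨_, _, (Fin.append_castAdd_natAdd).symm⟩
  have hdual (u : Fin n → ZMod 2) :
      ∑ i, Fin.append a b i * Fin.append u (u ᵥ* M) i = (a + M *ᵥ b) ⬝ᵥ u := by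
    rw [Fin.sum_univ_add]
    simp only [Fin.append_left, Fin.append_right]
    change a ⬝ᵥ u + b ⬝ᵥ (u ᵥ* M) = _
    rw [add_dotProduct, dotProduct_comm b, ← Matrix.dotProduct_mulVec, dotProduct_comm u]
  have hadd (c d : Fin n → ZMod 2) : c + d = 0 ↔ c = d := by
    simp only [funext_iff, Pi.add_apply, Pi.zero_apply, CharTwo.add_eq_zero]
  calc Fin.append a b ∈ rowCode M ↔ b = a ᵥ* M := by
        rw [mem_rowCode]
        refine ⟨?_, fun h => ⟨a, by rw [h]⟩⟩
        rintro ⟨u, hu⟩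
        obtain ⟨rfl, rfl⟩ := append_inj_iff.1 hu
        rfl
    _ ↔ a + M *ᵥ b = 0 := by
        rw [hadd]
        constructor
        · rintro rfl
          rw [← Matrix.vecMul_transpose, Matrix.vecMul_vecMul, hM, Matrix.vecMul_one]
        · intro h
          rw [h, ← Matrix.vecMul_transpose, Matrix.vecMul_vecMul, mul_eq_one_comm.1 hM,
            Matrix.vecMul_one]
    _ ↔ ∀ y ∈ rowCode M, ∑ i, Fin.append a b i * y i = 0 := by
        constructor
        · rintro h _ ⟨u, rfl⟩
          rw [hdual, h, zero_dotProduct]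
        · intro h
          exact dotProduct_eq_zero _ fun u => by rw [← hdual, h _ ⟨u, rfl⟩]

lemma hamWt_append {n : ℕ} (u v : Fin n → ZMod 2) :
    hamWt (Fin.append u v) = hamWt u + hamWt v := by
  simp only [hamWt, Finset.card_filter, Fin.sum_univ_add, Fin.append_left, Fin.append_right]

lemma card_hamWt_rowCode {n : ℕ} (M : Matrix (Fin n) (Fin n) (ZMod 2)) (m : ℕ) :
    Nat.card {v // v ∈ rowCode M ∧ hamWt v = m} =
      ∑ k ∈ Finset.range (m + 1), wtCount M k (m - k) := by
  have hcard : Nat.card {v // v ∈ rowCode M ∧ hamWt v = m} =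
      (Finset.univ.filter fun u : Fin n → ZMod 2 => hamWt u + hamWt (u ᵥ* M) = m).card := by
    rw [← Fintype.card_subtype, ← Nat.card_eq_fintype_card]
    refine (Nat.card_congr (Equiv.ofBijective
      (fun u => ⟨Fin.append u.1 (u.1 ᵥ* M), ⟨u.1, rfl⟩, by rw [hamWt_append]; exact u.2⟩)
      ⟨fun u v huv => Subtype.ext ?_, ?_⟩)).symm
    · exact (append_inj_iff.1 (Subtype.ext_iff.1 huv)).1
    · rintro ⟨_, ⟨u, rfl⟩, hu⟩
      exact ⟨⟨u, by rwa [hamWt_append] at hu⟩, rfl⟩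
  rw [hcard, Finset.card_eq_sum_card_fiberwise (f := hamWt) (t := Finset.range (m + 1))]
  · refine Finset.sum_congr rfl fun k hk => congrArg Finset.card ?_
    ext u
    simp only [Finset.mem_filter, Finset.mem_univ, true_and, Finset.mem_range] at hk ⊢
    omega
  · intro u hu
    simp only [Finset.coe_filter, Finset.mem_univ, true_and, Set.mem_ofPred_eq, Finset.coe_range,
      Set.mem_Iio] at hu ⊢
    omega

lemma hamWt_zero {ι : Type*} [Fintype ι] : hamWt (0 : ι → ZMod 2) = 0 := by
  simp [hamWt]

lemma wtCount_zero_left {n : ℕ} (M : Matrix (Fin n) (Fin n) (ZMod 2)) {j : ℕ} (hj : j ≠ 0) :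
    wtCount M 0 j = 0 := by
  rw [wtCount, Finset.card_eq_zero, Finset.filter_eq_empty_iff]
  rintro u - ⟨hu, h⟩
  rw [eq_zero_of_hamWt_eq_zero hu, Matrix.zero_vecMul, hamWt_zero] at h
  exact hj h.symm

/-- The matrix `M` for which the rows of `[1 | M]` span the code. -/
def circulantMatrix : Matrix (Fin 36) (Fin 36) (ZMod 2) := rowMatrix 36 generatorRows

lemma rowMatrix_transposeRows : rowMatrix 36 transposeRows = circulantMatrix.transpose := by
  decide +kernel

lemma circulantMatrix_mul_transpose : circulantMatrix * circulantMatrix.transpose = 1 := by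
  decide +kernel

set_option maxRecDepth 100000 in
lemma scan_generatorRows :
    scan (specs 1) initBlocks generatorRows = 288 + 2 ^ 64 * 2088 := by
  decide +kernel

set_option maxRecDepth 100000 in
lemma scan_transposeRows :
    scan (specs 0) initBlocks transposeRows = 180 + 2 ^ 64 * 1692 := by
  decide +kernel

set_option maxRecDepth 100000 in
lemma pairScan_generatorRows : pairScan [(7, 1)] initBlocks generatorRows = 3708 := by
  decide +kernel

attribute [irreducible] wtCount scan pairScan

lemma wtCount_of_scan_eq {rows : List ℕ} (hn : rows.length = 36) (hrows : ∀ a ∈ rows, a < 2 ^ 36)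
    {c x y : ℕ} (hc : c ≤ 1) (hx : x < 2 ^ 64) (hy : y < 2 ^ 64)
    (h : scan (specs c) initBlocks rows = y + 2 ^ 64 * x) :
    (∑ k ∈ Finset.range 5, wtCount (rowMatrix 36 rows) (k + 1) (11 - k)) +
        c * wtCount (rowMatrix 36 rows) 6 6 = y ∧
      ∑ k ∈ Finset.range 6, wtCount (rowMatrix 36 rows) (k + 1) (13 - k) = x ∧
      ∀ k < 5, ∀ j < 11 - k, wtCount (rowMatrix 36 rows) (k + 1) j = 0 := by
  have hle := wtCount_le (rowMatrix 36 rows)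
  have hsum (m s : ℕ) : ∑ k ∈ Finset.range m, wtCount (rowMatrix 36 rows) (k + 1) (s - k) ≤
      m * 2 ^ 36 := by
    simpa using Finset.sum_le_sum fun k (_ : k ∈ Finset.range m) => hle (k + 1) (s - k)
  have hmul : c * wtCount (rowMatrix 36 rows) 6 6 ≤ 1 * 2 ^ 36 := Nat.mul_le_mul hc (hle 6 6)
  have h₁ := hsum 5 11
  have h₂ := hsum 6 13
  rw [scan_eq hn hrows] at h
  generalize wtCount (rowMatrix 36 rows) = N at *
  refine ⟨by omega, by omega, fun k hk j hj => ?_⟩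
  have h₃ : ∑ k ∈ Finset.range 5, ∑ j ∈ Finset.range (11 - k),
      N (k + 1) j = 0 := by omega
  exact Finset.sum_eq_zero_iff.1 (Finset.sum_eq_zero_iff.1 h₃ k (Finset.mem_range.2 hk)) j
    (Finset.mem_range.2 hj)

lemma wtCount_swap_of_scan_eq {M : Matrix (Fin 36) (Fin 36) (ZMod 2)} (hM : M * M.transpose = 1)
    {rows : List ℕ} (hMrows : rowMatrix 36 rows = M.transpose) (hn : rows.length = 36)
    (hrows : ∀ a ∈ rows, a < 2 ^ 36) {c x y : ℕ} (hc : c ≤ 1) (hx : x < 2 ^ 64)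
    (hy : y < 2 ^ 64) (h : scan (specs c) initBlocks rows = y + 2 ^ 64 * x) :
    (∑ k ∈ Finset.range 5, wtCount M (11 - k) (k + 1)) + c * wtCount M 6 6 = y ∧
      ∑ k ∈ Finset.range 6, wtCount M (13 - k) (k + 1) = x ∧
      ∀ k < 5, ∀ j < 11 - k, wtCount M j (k + 1) = 0 := by
  simpa only [hMrows, wtCount_transpose hM] using wtCount_of_scan_eq hn hrows hc hx hy h

lemma generatorRows_lt : ∀ a ∈ generatorRows, a < 2 ^ 36 := by decide +kernel

lemma transposeRows_lt : ∀ a ∈ transposeRows, a < 2 ^ 36 := by decide +kernel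

lemma wtCount_circulantMatrix :
    (∑ k ∈ Finset.range 5, wtCount circulantMatrix (k + 1) (11 - k)) +
        1 * wtCount circulantMatrix 6 6 = 288 ∧
      ∑ k ∈ Finset.range 6, wtCount circulantMatrix (k + 1) (13 - k) = 2088 ∧
      ∀ k < 5, ∀ j < 11 - k, wtCount circulantMatrix (k + 1) j = 0 := by
  rw [circulantMatrix]
  exact wtCount_of_scan_eq (c := 1) rfl generatorRows_lt le_rfl (by norm_num) (by norm_num)
    scan_generatorRows

lemma wtCount_circulantMatrix_swap :
    (∑ k ∈ Finset.range 5, wtCount circulantMatrix (11 - k) (k + 1)) +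
        0 * wtCount circulantMatrix 6 6 = 180 ∧
      ∑ k ∈ Finset.range 6, wtCount circulantMatrix (13 - k) (k + 1) = 1692 ∧
      ∀ k < 5, ∀ j < 11 - k, wtCount circulantMatrix j (k + 1) = 0 :=
  wtCount_swap_of_scan_eq (c := 0) circulantMatrix_mul_transpose rowMatrix_transposeRows rfl
    transposeRows_lt zero_le_one (by norm_num) (by norm_num) scan_transposeRows

lemma wtCount_circulantMatrix_seven : wtCount circulantMatrix 7 7 = 3708 := by
  rw [circulantMatrix, ← pairScan_eq rfl generatorRows_lt, pairScan_generatorRows]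

lemma wtCount_circulantMatrix_zero_left {j : ℕ} (hj : j ≠ 0) : wtCount circulantMatrix 0 j = 0 :=
  wtCount_zero_left _ hj

lemma wtCount_circulantMatrix_zero_right {k : ℕ} (hk : k ≠ 0) :
    wtCount circulantMatrix k 0 = 0 := by
  rw [← wtCount_transpose circulantMatrix_mul_transpose, wtCount_zero_left _ hk]

lemma wtCount_circulantMatrix_eq_zero {k j : ℕ} (h₀ : k + j ≠ 0) (h : k + j < 12) :
    wtCount circulantMatrix k j = 0 := by
  obtain rfl | hk := eq_or_ne k 0
  · exact wtCount_circulantMatrix_zero_left (by omega)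
  obtain rfl | hj := eq_or_ne j 0
  · exact wtCount_circulantMatrix_zero_right hk
  obtain ⟨k, rfl⟩ := Nat.exists_eq_succ_of_ne_zero hk
  obtain ⟨j, rfl⟩ := Nat.exists_eq_succ_of_ne_zero hj
  by_cases hk5 : k < 5
  · exact wtCount_circulantMatrix.2.2 k hk5 _ (by omega)
  · exact wtCount_circulantMatrix_swap.2.2 j (by omega) _ (by omega)

lemma sum_range_thirteen (N : ℕ → ℕ → ℕ) :
    ∑ k ∈ Finset.range 13, N k (12 - k) = N 0 12 +
      ((∑ k ∈ Finset.range 5, N (k + 1) (11 - k)) + 1 * N 6 6) +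
      ((∑ k ∈ Finset.range 5, N (11 - k) (k + 1)) + 0 * N 6 6) + N 12 0 := by
  simp only [Finset.sum_range_succ, Finset.sum_range_zero, Nat.reduceAdd, Nat.reduceSub]
  omega

lemma sum_range_fifteen (N : ℕ → ℕ → ℕ) :
    ∑ k ∈ Finset.range 15, N k (14 - k) = N 0 14 +
      ∑ k ∈ Finset.range 6, N (k + 1) (13 - k) + N 7 7 +
      ∑ k ∈ Finset.range 6, N (13 - k) (k + 1) + N 14 0 := by
  simp only [Finset.sum_range_succ, Finset.sum_range_zero, Nat.reduceAdd, Nat.reduceSub]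
  omega

lemma card_rowCode_twelve :
    Nat.card {v // v ∈ rowCode circulantMatrix ∧ hamWt v = 12} = 468 := by
  rw [card_hamWt_rowCode, sum_range_thirteen, wtCount_circulantMatrix.1,
    wtCount_circulantMatrix_swap.1, wtCount_circulantMatrix_zero_left (by norm_num),
    wtCount_circulantMatrix_zero_right (by norm_num)]

lemma card_rowCode_fourteen :
    Nat.card {v // v ∈ rowCode circulantMatrix ∧ hamWt v = 14} = 7488 := by
  rw [card_hamWt_rowCode, sum_range_fifteen, wtCount_circulantMatrix.2.1,
    wtCount_circulantMatrix_swap.2.1, wtCount_circulantMatrix_zero_left (by norm_num),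
    wtCount_circulantMatrix_zero_right (by norm_num), wtCount_circulantMatrix_seven]

lemma twelve_le_hamWt_of_mem_rowCode {v : Fin (36 + 36) → ZMod 2}
    (hv : v ∈ rowCode circulantMatrix) (hv₀ : v ≠ 0) : 12 ≤ hamWt v := by
  by_contra! hlt
  have hne : hamWt v ≠ 0 := fun h => hv₀ (eq_zero_of_hamWt_eq_zero h)
  have hcard := card_hamWt_rowCode circulantMatrix (hamWt v)
  rw [Finset.sum_eq_zero fun k hk => wtCount_circulantMatrix_eq_zero
    (by rw [Finset.mem_range] at hk; omega) (by rw [Finset.mem_range] at hk; omega),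
    Finite.card_eq_zero_iff] at hcard
  exact hcard.false ⟨v, hv, rfl⟩

/-- There is a self-dual binary linear code of length 72 with minimum nonzero Hamming
weight 12, having exactly 468 codewords of weight 12 and exactly 7488 codewords of
weight 14 (weight enumerator `W_{72,1}` with γ = 18 and β = 234). -/
theorem exists_selfDual_code_72_gamma_18_beta_234 :
    ∃ C : Submodule (ZMod 2) (Fin 72 → ZMod 2),
      IsSelfDual C ∧
      IsLeast {k | ∃ v ∈ C, v ≠ 0 ∧ hamWt v = k} 12 ∧
      Nat.card {v : Fin 72 → ZMod 2 // v ∈ C ∧ hamWt v = 12} = 468 ∧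
      Nat.card {v : Fin 72 → ZMod 2 // v ∈ C ∧ hamWt v = 14} = 7488 := by
  refine ⟨rowCode circulantMatrix, isSelfDual_rowCode circulantMatrix_mul_transpose, ⟨?_, ?_⟩,
    card_rowCode_twelve, card_rowCode_fourteen⟩
  · obtain ⟨⟨v, hv, h⟩⟩ : Nonempty {v // v ∈ rowCode circulantMatrix ∧ hamWt v = 12} :=
      (Nat.card_pos_iff.1 (by rw [card_rowCode_twelve]; norm_num)).1
    refine ⟨v, hv, ?_, h⟩
    rintro rfl
    rw [hamWt_zero] at h
    exact absurd h (by norm_num)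
  · rintro _ ⟨v, hv, hv₀, rfl⟩
    exact twelve_le_hamWt_of_mem_rowCode hv hv₀
end

section
/- There exists a self-dual binary linear code C ⊆ F₂^{72} whose minimum nonzero Hamming weight is 12, which contains exactly 522 codewords of Hamming weight 12 and exactly 7488 codewords of Hamming weight 14 (the weight enumerator W_{72,1} with γ = 18 and β = 261). -/
/-! ### Strict evaluation

Each function below returns its continuation applied to its first argument; the kernel
reduces that argument to literals first. -/

/-- Apply `f` to `n` after evaluating `n`. -/
def withNat {α : Type*} (n : ℕ) (f : ℕ → α) : α :=
  match n with
  | 0 => f 0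
  | m + 1 => f m.succ

/-- Apply `f` to a list of numbers after evaluating its entries. -/
def withNats {α : Type*} : List ℕ → (List ℕ → α) → α
  | [], f => f []
  | x :: l, f => withNat x fun y => withNats l fun l' => f (y :: l')

/-- Apply `f` to a list of pairs of numbers after evaluating its entries. -/
def withPairs {α : Type*} : List (ℕ × ℕ) → (List (ℕ × ℕ) → α) → α
  | [], f => f []
  | (m, n) :: l, f =>
    withNat m fun m' => withNat n fun n' => withPairs l fun l' => f ((m', n') :: l')

@[simp] theorem withNat_eq {α : Type*} (n : ℕ) (f : ℕ → α) : withNat n f = f n := by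
  cases n <;> rfl

@[simp] theorem withNats_eq {α : Type*} (l : List ℕ) (f : List ℕ → α) :
    withNats l f = f l := by
  induction l generalizing f with
  | nil => rfl
  | cons x l ih => simp [withNats, ih]

@[simp] theorem withPairs_eq {α : Type*} (l : List (ℕ × ℕ)) (f : List (ℕ × ℕ) → α) :
    withPairs l f = f l := by
  induction l generalizing f with
  | nil => rfl
  | cons x l ih => simp [withPairs, ih]

/-! ### Truth tables packed into natural numbers -/

section TruthTable

variable {ι : Type*}

/-- The number whose binary digits, least significant first, are the values of `f` on `S`. -/
def truthTable (S : List ι) (f : ι → Bool) : ℕ :=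
  S.foldr (fun i n => Nat.bit (f i) n) 0

@[simp] theorem truthTable_nil (f : ι → Bool) : truthTable [] f = 0 := rfl

@[simp] theorem truthTable_cons (a : ι) (S : List ι) (f : ι → Bool) :
    truthTable (a :: S) f = Nat.bit (f a) (truthTable S f) := rfl

theorem truthTable_map {κ : Type*} (e : κ → ι) (S : List κ) (f : ι → Bool) :
    truthTable (S.map e) f = truthTable S fun i => f (e i) := by
  simp [truthTable, List.foldr_map]

theorem truthTable_xor (S : List ι) (f g : ι → Bool) :
    truthTable S f ^^^ truthTable S g = truthTable S fun i => f i ^^ g i := by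
  induction S with
  | nil => simp
  | cons a S ih => simp [Nat.xor_bit, ih]

theorem truthTable_and (S : List ι) (f g : ι → Bool) :
    truthTable S f &&& truthTable S g = truthTable S fun i => f i && g i := by
  induction S with
  | nil => simp
  | cons a S ih => simp [Nat.land_bit, ih]

@[simp] theorem truthTable_false (S : List ι) : truthTable S (fun _ => false) = 0 := by
  induction S with
  | nil => rfl
  | cons a S ih => simp [ih]

theorem truthTable_true (S : List ι) : truthTable S (fun _ => true) = 2 ^ S.length - 1 := by
  induction S with
  | nil => rfl
  | cons a S ih =>
    have := Nat.one_le_two_pow (n := S.length)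
    simp only [truthTable_cons, ih, Nat.bit_val, Bool.toNat_true, List.length_cons, pow_succ]
    lia

theorem truthTable_append (S T : List ι) (f : ι → Bool) :
    truthTable (S ++ T) f = truthTable S f + truthTable T f <<< S.length := by
  induction S with
  | nil => simp
  | cons a S ih =>
    simp only [List.cons_append, truthTable_cons, ih, Nat.bit_val, List.length_cons,
      Nat.shiftLeft_eq, pow_succ]
    ring

/-- The number of ones among the lowest `N` binary digits of `x`. -/
def bitCount (N x : ℕ) : ℕ := ∑ i ∈ Finset.range N, (x.testBit i).toNat

@[simp] theorem bitCount_zero_right (N : ℕ) : bitCount N 0 = 0 := by simp [bitCount]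

theorem bitCount_truthTable (S : List ι) (f : ι → Bool) {N : ℕ} (h : S.length ≤ N) :
    bitCount N (truthTable S f) = S.countP f := by
  induction S generalizing N with
  | nil => simp
  | cons a S ih =>
    obtain ⟨N, rfl⟩ : ∃ M, N = M + 1 := ⟨N - 1, by simp at h; lia⟩
    have := ih (N := N) (by simpa using h)
    rw [bitCount] at this
    rw [bitCount, Finset.sum_range_succ', List.countP_cons]
    simp [Nat.testBit_bit_succ, this]
    cases f a <;> rfl

end TruthTable

/-! ### Counting the ones of a large number -/

/-- Bitwise sum of two lists of binary digits with carry `c`. -/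
def addSlices : ℕ → List ℕ → List ℕ → List ℕ
  | c, x :: s, y :: t => (x ^^^ y ^^^ c) :: addSlices ((x &&& y) ^^^ (c &&& (x ^^^ y))) s t
  | c, _, _ => [c]

/-- The sum of the `2 ^ d` numbers whose binary digits are given by the bits of the
numbers in `s`. -/
def foldCount : ℕ → List ℕ → ℕ
  | 0, s => s.foldr (fun x n => x % 2 + 2 * n) 0
  | d + 1, s =>
    withNats (s.map (· >>> 2 ^ d)) fun hi =>
    withNats (List.zipWith (fun x y => x ^^^ (y <<< 2 ^ d)) s hi) fun lo =>
    withNats (addSlices 0 lo hi) (foldCount d)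

/-- The number of ones among the lowest `2 ^ d` binary digits of `x`. -/
def popCount (d x : ℕ) : ℕ := withNat x fun y => foldCount d [y]

/-- The sum over the lowest `N` bit positions of the numbers with binary digits in `s`. -/
def sliceSum (N : ℕ) (s : List ℕ) : ℕ := s.foldr (fun x n => bitCount N x + 2 * n) 0

theorem bitCount_full_adder (N x y c : ℕ) :
    bitCount N (x ^^^ y ^^^ c) + 2 * bitCount N ((x &&& y) ^^^ (c &&& (x ^^^ y))) =
      bitCount N x + bitCount N y + bitCount N c := by
  simp only [bitCount, Finset.mul_sum, ← Finset.sum_add_distrib]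
  refine Finset.sum_congr rfl fun i _ => ?_
  simp only [Nat.testBit_xor, Nat.testBit_and]
  cases x.testBit i <;> cases y.testBit i <;> cases c.testBit i <;> rfl

theorem sliceSum_addSlices (N : ℕ) (c : ℕ) (s t : List ℕ) (h : s.length = t.length) :
    sliceSum N (addSlices c s t) = bitCount N c + sliceSum N s + sliceSum N t := by
  induction s generalizing c t with
  | nil =>
    obtain rfl : t = [] := by simpa using h.symm
    simp [addSlices, sliceSum]
  | cons x s ih =>
    obtain _ | ⟨y, t⟩ := t
    · simp at h
    · have h₁ := ih ((x &&& y) ^^^ (c &&& (x ^^^ y))) t (by simpa using h)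
      have h₂ := bitCount_full_adder N x y c
      simp only [sliceSum, addSlices, List.foldr_cons] at h₁ ⊢
      lia

theorem bitCount_split (N x : ℕ) :
    bitCount (N + N) x = bitCount N (x ^^^ ((x >>> N) <<< N)) + bitCount N (x >>> N) := by
  simp only [bitCount, Finset.sum_range_add]
  congr 1
  · refine Finset.sum_congr rfl fun i hi => ?_
    have : ¬ N ≤ i := by simpa using hi
    simp [Nat.testBit_shiftLeft, this]
  · simp [Nat.testBit_shiftRight]

theorem foldCount_eq (d : ℕ) (s : List ℕ) : foldCount d s = sliceSum (2 ^ d) s := by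
  induction d generalizing s with
  | zero =>
    induction s with
    | nil => rfl
    | cons x s ih =>
      simp only [foldCount, sliceSum, List.foldr_cons] at ih ⊢
      rw [ih]
      simp [bitCount, Nat.testBit_zero]
      obtain h | h := Nat.mod_two_eq_zero_or_one x <;> simp [h]
  | succ d ih =>
    simp only [foldCount, withNats_eq, ih]
    rw [sliceSum_addSlices _ _ _ _ (by simp)]
    induction s with
    | nil => simp [sliceSum]
    | cons x s ihs =>
      have := bitCount_split (2 ^ d) x
      simp only [sliceSum, bitCount_zero_right, List.map_cons, List.zipWith_cons_cons,
        List.foldr_cons, pow_succ, mul_two] at ihs this ⊢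
      lia

theorem popCount_eq (d x : ℕ) : popCount d x = bitCount (2 ^ d) x := by
  simp [popCount, foldCount_eq, sliceSum]

/-! ### Parities over all sublists of a given length -/

section Parity

variable {ι : Type*}

/-- Whether `f` is true at an odd number of entries of a list. -/
def oddOn (f : ι → Bool) (s : List ι) : Bool := s.foldr (fun i b => f i ^^ b) false

/-- Concatenate a table `q` with a table `p` that is complemented if `b` holds. Tables are
given with their lengths. -/
def glue (b : Bool) (p q : ℕ × ℕ) : ℕ × ℕ :=
  (q.1 + p.1, q.2 + (if b then p.2 ^^^ (2 ^ p.1 - 1) else p.2) <<< q.1)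

/-- Glue each table of a list to its predecessor. -/
def glueAll (b : Bool) : ℕ × ℕ → List (ℕ × ℕ) → List (ℕ × ℕ)
  | _, [] => []
  | p, q :: l => glue b p q :: glueAll b q l

/-- Update the tables of parities when an entry `b` is put in front. -/
def parityStep (b : Bool) : List (ℕ × ℕ) → List (ℕ × ℕ)
  | [] => []
  | p :: l => withPairs (glueAll b p l) fun l' => p :: l'

/-- For `r = 0, …, k`, the number of sublists of length `r` of the given list and the table
of their parities. -/
def parityTables (k : ℕ) : List Bool → List (ℕ × ℕ)
  | [] => (1, 0) :: List.replicate k (0, 0)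
  | b :: c => parityStep b (parityTables k c)

/-- The specification of the entries of `parityTables`. -/
def parityTable (L : List ι) (f : ι → Bool) (r : ℕ) : ℕ × ℕ :=
  ((L.sublistsLen r).length, truthTable (L.sublistsLen r) (oddOn f))

theorem glue_parityTable (a : ι) (L : List ι) (f : ι → Bool) (r : ℕ) :
    glue (f a) (parityTable L f r) (parityTable L f (r + 1)) =
      parityTable (a :: L) f (r + 1) := by
  simp only [glue, parityTable, ← truthTable_true, truthTable_xor, List.sublistsLen_succ_cons,
    truthTable_append, truthTable_map, List.length_append, List.length_map]
  congr 3
  cases h : f a <;> simp [oddOn, h]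
  rfl

theorem glueAll_parityTable (a : ι) (L : List ι) (f : ι → Bool) (r n : ℕ) :
    glueAll (f a) (parityTable L f r) ((List.range' (r + 1) n).map (parityTable L f)) =
      (List.range' (r + 1) n).map (parityTable (a :: L) f) := by
  induction n generalizing r with
  | zero => rfl
  | succ n ih => simp [List.range'_succ, glueAll, glue_parityTable, ih]

theorem parityTables_eq (k : ℕ) (L : List ι) (f : ι → Bool) :
    parityTables k (L.map f) = (List.range' 0 (k + 1)).map (parityTable L f) := by
  induction L with
  | nil =>
    simp only [List.range'_succ, List.map_nil, parityTables, List.map_cons, List.cons.injEq]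
    refine ⟨by simp [parityTable, oddOn], (List.eq_replicate_iff.2 ⟨by simp, ?_⟩).symm⟩
    intro p hp
    obtain ⟨r, hr, rfl⟩ := List.mem_map.1 hp
    obtain ⟨r, rfl⟩ : ∃ t, r = t + 1 := ⟨r - 1, by simp at hr; lia⟩
    simp [parityTable]
  | cons a L ih =>
    simp only [List.map_cons, parityTables, ih, List.range'_succ, parityStep, withPairs_eq,
      glueAll_parityTable]
    simp [parityTable, oddOn]

end Parity

/-! ### Bit-sliced counters -/

section Counter

variable {ι : Type*}

/-- The `m` lowest binary digits of a function `v` on `S`, as truth tables. -/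
def slices (S : List ι) : ℕ → (ι → ℕ) → List ℕ
  | 0, _ => []
  | m + 1, v => truthTable S (fun i => (v i).testBit 0) :: slices S m fun i => v i / 2

/-- Add a single bit to a bit-sliced counter. -/
def addBit : List ℕ → ℕ → List ℕ
  | [], _ => []
  | x :: s, y => (x ^^^ y) :: addBit s (x &&& y)

/-- Keep those bits of `acc` at which the bit-sliced counter has the value `w`. -/
def selectEq (acc : ℕ) : List ℕ → ℕ → ℕ
  | [], _ => acc
  | x :: s, w => withNat (bif w.testBit 0 then acc &&& x else acc ^^^ (acc &&& x)) fun acc' =>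
      selectEq acc' s (w / 2)

theorem slices_zero (S : List ι) (m : ℕ) :
    slices S m (fun _ => 0) = List.replicate m 0 := by
  induction m with
  | zero => rfl
  | succ m ih => simp [slices, ih, List.replicate_succ]

theorem addBit_slices (S : List ι) (m : ℕ) (v : ι → ℕ) (f : ι → Bool) :
    addBit (slices S m v) (truthTable S f) = slices S m fun i => v i + (f i).toNat := by
  induction m generalizing v f with
  | zero => rfl
  | succ m ih =>
    simp only [slices, addBit, truthTable_xor, truthTable_and, ih, List.cons.injEq]
    constructor
    · congr 1
      funext i
      cases f i <;> simp [Nat.testBit_zero, Nat.add_mod]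
      obtain h | h := Nat.mod_two_eq_zero_or_one (v i) <;> simp [h]
    · congr 1
      funext i
      obtain h | h := Nat.mod_two_eq_zero_or_one (v i) <;> cases f i <;>
        simp [Nat.testBit_zero, h] <;> lia

theorem selectEq_slices (S : List ι) (m : ℕ) (g : ι → Bool) (v : ι → ℕ) (w : ℕ)
    (hv : ∀ i, v i < 2 ^ m) (hw : w < 2 ^ m) :
    selectEq (truthTable S g) (slices S m v) w = truthTable S fun i => g i && (v i == w) := by
  induction m generalizing g v w with
  | zero =>
    have h : ∀ i, v i = w := fun i => by have := hv i; simp at this hw; lia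
    simp [slices, selectEq, h]
  | succ m ih =>
    have key : (bif w.testBit 0 then
        truthTable S g &&& truthTable S (fun i => (v i).testBit 0)
        else truthTable S g ^^^ (truthTable S g &&& truthTable S (fun i => (v i).testBit 0))) =
        truthTable S fun i => g i && ((v i).testBit 0 == w.testBit 0) := by
      simp only [truthTable_and, truthTable_xor]
      cases w.testBit 0 <;> simp only [cond_true, cond_false] <;> congr 1 <;> funext i <;>
        cases g i <;> cases (v i).testBit 0 <;> rfl
    simp only [slices, selectEq, withNat_eq, key]
    rw [ih _ _ _ (fun i => by have := hv i; rw [pow_succ] at this; lia)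
      (by rw [pow_succ] at hw; lia)]
    congr 1
    funext i
    rw [Bool.and_assoc]
    congr 1
    rw [Bool.eq_iff_iff]
    simp only [Nat.testBit_zero, Bool.and_eq_true, beq_iff_eq, decide_eq_decide]
    lia

/-- Add to a bit-sliced counter, indexed by the sublists of length `k`, the parities of the
given columns. -/
def addColumns (k : ℕ) : List (List Bool) → List ℕ → List ℕ
  | [], s => s
  | c :: cs, s => withNat ((parityTables k c).getD k (0, 0)).2 fun y =>
      withNats (addBit s y) fun s' => addColumns k cs s'

theorem addColumns_slices {κ : Type*} (k m : ℕ) (L : List ι) (J : List κ) (B : κ → ι → Bool)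
    (v : List ι → ℕ) :
    addColumns k (J.map fun j => L.map (B j)) (slices (L.sublistsLen k) m v) =
      slices (L.sublistsLen k) m fun s => v s + J.countP fun j => oddOn (B j) s := by
  induction J generalizing v with
  | nil => rfl
  | cons j J ih =>
    have h : ((parityTables k (L.map (B j))).getD k (0, 0)).2 =
        truthTable (L.sublistsLen k) (oddOn (B j)) := by
      simp [parityTables_eq, parityTable]
    simp only [List.map_cons, addColumns, withNat_eq, withNats_eq, h, addBit_slices, ih,
      List.countP_cons]
    congr 1
    funext s
    cases oddOn (B j) s <;> simp
    lia

/-- For `w < l`, the number of `k`-subsets of rows of `B` whose sum has weight `w`, computed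
with `m`-bit counters on tables of length at most `2 ^ d`. -/
def weightCounts {n : ℕ} (B : Fin n → Fin n → Bool) (d m k l : ℕ) : List ℕ :=
  withNats (addColumns k ((List.finRange n).map fun j => (List.finRange n).map fun i => B i j)
    (List.replicate m 0)) fun s =>
  (List.range l).map fun w => popCount d (selectEq (2 ^ n.choose k - 1) s w)

theorem weightCounts_eq {n : ℕ} (B : Fin n → Fin n → Bool) {d m k l : ℕ}
    (hd : n.choose k ≤ 2 ^ d) (hm : n < 2 ^ m) (hl : l ≤ 2 ^ m) :
    weightCounts B d m k l = (List.range l).map fun w =>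
      ((List.finRange n).sublistsLen k).countP fun s =>
        (List.finRange n).countP (fun j => oddOn (fun i => B i j) s) == w := by
  have hlen : ((List.finRange n).sublistsLen k).length = n.choose k := by simp
  rw [weightCounts, withNats_eq, ← slices_zero ((List.finRange n).sublistsLen k),
    addColumns_slices, ← hlen, ← truthTable_true]
  refine List.map_congr_left fun w hw => ?_
  rw [selectEq_slices, popCount_eq, bitCount_truthTable _ _ (hlen.trans_le hd)]
  · simp
  · intro s
    have := (List.finRange n).countP_le_length (p := fun j => oddOn (fun i => B i j) s)
    simp at this
    lia
  · have := List.mem_range.1 hw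
    lia

end Counter

/-! ### Codes with generator matrix `(I | A)` -/

section GraphCode

open Matrix

variable {n : ℕ}

/-- The matrix over `ZMod 2` with the given entries. -/
def bitMatrix (B : Fin n → Fin n → Bool) : Matrix (Fin n) (Fin n) (ZMod 2) :=
  Matrix.of fun i j => if B i j then 1 else 0

/-- The number of vectors `u` of weight `k` such that `u A` has weight `l`. -/
def splitCount (A : Matrix (Fin n) (Fin n) (ZMod 2)) (k l : ℕ) : ℕ :=
  (Finset.univ.filter fun u : Fin n → ZMod 2 => hamWt u = k ∧ hamWt (u ᵥ* A) = l).card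

theorem oddOn_iff {ι : Type*} (f : ι → Bool) (s : List ι) :
    oddOn f s = true ↔ (s.map fun i => if f i then (1 : ZMod 2) else 0).sum ≠ 0 := by
  have two : (1 + 1 : ZMod 2) = 0 := rfl
  have key : (s.map fun i => if f i then (1 : ZMod 2) else 0).sum =
      if oddOn f s then 1 else 0 := by
    induction s with
    | nil => rfl
    | cons a s ih =>
      rw [List.map_cons, List.sum_cons, ih]
      change _ = if (f a ^^ oddOn f s) = true then _ else _
      cases f a <;> cases oddOn f s <;> simp [two]
  rw [key]
  cases oddOn f s <;> simp

theorem vecMul_bitMatrix (B : Fin n → Fin n → Bool) (u : Fin n → ZMod 2) (j : Fin n) :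
    (u ᵥ* bitMatrix B) j = ∑ i with u i ≠ 0, if B i j then 1 else 0 := by
  have bit (a : ZMod 2) : a = 0 ∨ a = 1 := by decide +revert
  simp only [vecMul, dotProduct, Finset.sum_filter]
  refine Finset.sum_congr rfl fun i _ => ?_
  obtain h | h := bit (u i) <;> simp [h, bitMatrix]

theorem splitCount_bitMatrix (B : Fin n → Fin n → Bool) (k w : ℕ) :
    splitCount (bitMatrix B) k w =
      ((List.finRange n).sublistsLen k).countP fun s =>
        (List.finRange n).countP (fun j => oddOn (fun i => B i j) s) == w := by
  have bit (a : ZMod 2) : a ≠ 0 → a = 1 := by decide +revert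
  let P : Multiset (Fin n) → Prop := fun s =>
    (Finset.univ.filter fun j =>
      (s.map fun i => if B i j then (1 : ZMod 2) else 0).sum ≠ 0).card = w
  have h₁ : splitCount (bitMatrix B) k w =
      ((Finset.powersetCard k (Finset.univ : Finset (Fin n))).filter fun s => P s.1).card := by
    have hP (u : Fin n → ZMod 2) :
        P (Finset.univ.filter fun i => u i ≠ 0).1 ↔ hamWt (u ᵥ* bitMatrix B) = w := by
      simp only [P, hamWt, vecMul_bitMatrix, Finset.sum]
    refine Finset.card_bij (fun u _ => Finset.univ.filter fun i => u i ≠ 0) ?_ ?_ ?_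
    · intro u hu
      rw [Finset.mem_filter_univ] at hu
      exact Finset.mem_filter.2 ⟨Finset.mem_powersetCard_univ.2 hu.1, (hP u).2 hu.2⟩
    · intro u _ v _ h
      funext i
      have h' : u i ≠ 0 ↔ v i ≠ 0 := by simpa using Finset.ext_iff.1 h i
      by_cases hu : u i = 0
      · rw [hu, not_ne_iff.1 (mt h'.2 (not_ne_iff.2 hu))]
      · rw [bit _ hu, bit _ (h'.1 hu)]
    · intro s hs
      have h : (Finset.univ.filter fun i => (if i ∈ s then (1 : ZMod 2) else 0) ≠ 0) = s := by
        simp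
      rw [Finset.mem_filter, Finset.mem_powersetCard_univ] at hs
      refine ⟨fun i => if i ∈ s then 1 else 0, Finset.mem_filter_univ _ |>.2 ⟨?_, ?_⟩, h⟩
      · rw [hamWt, h, hs.1]
      · rw [← hP, h]
        exact hs.2
  have h₂ : ((Finset.powersetCard k (Finset.univ : Finset (Fin n))).filter
      fun s => P s.1).card = ((Finset.univ : Finset (Fin n)).1.powersetCard k).countP P := by
    rw [← Finset.map_val_val_powersetCard, Multiset.countP_map]
    rfl
  have h₃ : (Finset.univ : Finset (Fin n)).1 = (List.finRange n : Multiset (Fin n)) := rfl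
  rw [h₁, h₂, h₃, Multiset.powersetCard_coe, Multiset.coe_countP, List.countP_map]
  refine List.countP_congr fun s _ => ?_
  have h₄ : (Finset.univ.filter fun j => oddOn (fun i => B i j) s = true).card =
      (List.finRange n).countP fun j => oddOn (fun i => B i j) s := by
    rw [Finset.card_def, Finset.filter_val, ← Multiset.countP_eq_card_filter, h₃,
      Multiset.coe_countP]
    simp
  simp only [oddOn_iff] at h₄
  rw [beq_iff_eq, ← h₄]
  exact decide_eq_true_iff

theorem splitCount_transpose {A : Matrix (Fin n) (Fin n) (ZMod 2)} (hA : A * Aᵀ = 1)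
    (k l : ℕ) : splitCount A k l = splitCount Aᵀ l k := by
  have hA' : Aᵀ * A = 1 := mul_eq_one_comm.1 hA
  refine Finset.card_nbij' (fun u => u ᵥ* A) (fun u => u ᵥ* Aᵀ) ?_ ?_ ?_ ?_
  · intro u
    simp +contextual [vecMul_vecMul, hA]
  · intro u
    simp +contextual [vecMul_vecMul, hA']
  · intro u _
    simp [vecMul_vecMul, hA]
  · intro u _
    simp [vecMul_vecMul, hA']

/-- The code with generator matrix `(I | A)`. -/
def graphCode (A : Matrix (Fin n) (Fin n) (ZMod 2)) :
    Submodule (ZMod 2) (Fin (n + n) → ZMod 2) where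
  carrier := {x | (fun i => x (Fin.natAdd n i)) = (fun i => x (Fin.castAdd n i)) ᵥ* A}
  add_mem' {x y} hx hy := by
    change (fun i => x (Fin.natAdd n i)) + (fun i => y (Fin.natAdd n i)) =
      ((fun i => x (Fin.castAdd n i)) + fun i => y (Fin.castAdd n i)) ᵥ* A
    rw [add_vecMul, ← hx, ← hy]
  zero_mem' := by
    change (0 : Fin n → ZMod 2) = 0 ᵥ* A
    simp
  smul_mem' c x hx := by
    change c • (fun i => x (Fin.natAdd n i)) = (c • fun i => x (Fin.castAdd n i)) ᵥ* A
    rw [smul_vecMul, ← hx]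

theorem mem_graphCode {A : Matrix (Fin n) (Fin n) (ZMod 2)} {x : Fin (n + n) → ZMod 2} :
    x ∈ graphCode A ↔ (fun i => x (Fin.natAdd n i)) = (fun i => x (Fin.castAdd n i)) ᵥ* A :=
  Iff.rfl

theorem append_mem_graphCode (A : Matrix (Fin n) (Fin n) (ZMod 2)) (u : Fin n → ZMod 2) :
    Fin.append u (u ᵥ* A) ∈ graphCode A := by
  simp only [mem_graphCode, Fin.append_left, Fin.append_right]

theorem isSelfDual_graphCode {A : Matrix (Fin n) (Fin n) (ZMod 2)} (hA : A * Aᵀ = 1) :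
    IsSelfDual (graphCode A) := by
  intro x
  set l : Fin n → ZMod 2 := fun i => x (Fin.castAdd n i)
  set r : Fin n → ZMod 2 := fun i => x (Fin.natAdd n i)
  have hprod (y : Fin (n + n) → ZMod 2) (hy : y ∈ graphCode A) :
      ∑ i, x i * y i = (l + r ᵥ* Aᵀ) ⬝ᵥ fun i => y (Fin.castAdd n i) := by
    have h : r ⬝ᵥ (fun i => y (Fin.natAdd n i)) =
        (r ᵥ* Aᵀ) ⬝ᵥ fun i => y (Fin.castAdd n i) := by
      rw [mem_graphCode.1 hy, vecMul_transpose, ← mulVec_transpose, dotProduct_mulVec,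
        ← mulVec_transpose, transpose_transpose]
    rw [Fin.sum_univ_add, add_dotProduct, ← h]
    rfl
  have hneg (v : Fin n → ZMod 2) : -v = v := funext fun i => CharTwo.neg_eq (v i)
  have hmem : x ∈ graphCode A ↔ l + r ᵥ* Aᵀ = 0 := by
    rw [mem_graphCode, add_eq_zero_iff_eq_neg, hneg]
    change r = l ᵥ* A ↔ _
    constructor
    · rintro h
      rw [h, vecMul_vecMul, hA, vecMul_one]
    · rintro h
      rw [h, vecMul_vecMul, mul_eq_one_comm.1 hA, vecMul_one]
  rw [hmem]
  constructor
  · intro h y hy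
    rw [hprod y hy, h, zero_dotProduct]
  · intro h
    refine dotProduct_eq_zero _ fun u => ?_
    have := h _ (append_mem_graphCode A u)
    rw [hprod _ (append_mem_graphCode A u)] at this
    simpa using this

theorem hamWt_split (x : Fin (n + n) → ZMod 2) :
    hamWt x = hamWt (fun i => x (Fin.castAdd n i)) + hamWt fun i => x (Fin.natAdd n i) := by
  simp [hamWt, Finset.card_filter, Fin.sum_univ_add]

theorem card_graphCode_hamWt (A : Matrix (Fin n) (Fin n) (ZMod 2)) (w : ℕ) :
    Nat.card {v : Fin (n + n) → ZMod 2 // v ∈ graphCode A ∧ hamWt v = w} =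
      ∑ p ∈ Finset.HasAntidiagonal.antidiagonal w, splitCount A p.1 p.2 := by
  have e : {v : Fin (n + n) → ZMod 2 // v ∈ graphCode A ∧ hamWt v = w} ≃
      {u : Fin n → ZMod 2 // hamWt u + hamWt (u ᵥ* A) = w} :=
    { toFun := fun v => ⟨fun i => v.1 (Fin.castAdd n i), by
        rw [← mem_graphCode.1 v.2.1, ← hamWt_split, v.2.2]⟩
      invFun := fun u => ⟨Fin.append u.1 (u.1 ᵥ* A), append_mem_graphCode A _, by
        simpa only [hamWt_split, Fin.append_left, Fin.append_right] using u.2⟩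
      left_inv := fun v => by
        ext i
        dsimp only
        rw [← mem_graphCode.1 v.2.1]
        refine Fin.addCases (fun i => ?_) (fun i => ?_) i <;>
          simp only [Fin.append_left, Fin.append_right]
      right_inv := fun u => by
        ext i
        simp }
  rw [Nat.card_congr e, Nat.card_eq_fintype_card, Fintype.card_subtype]
  rw [Finset.card_eq_sum_card_fiberwise (f := fun u => (hamWt u, hamWt (u ᵥ* A)))
    (t := Finset.HasAntidiagonal.antidiagonal w) (by intro u; simp)]
  refine Finset.sum_congr rfl fun p hp => ?_
  rw [splitCount, Finset.filter_filter]
  congr 1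
  refine Finset.filter_congr fun u _ => ?_
  rw [Finset.HasAntidiagonal.mem_antidiagonal] at hp
  rw [Prod.ext_iff]
  constructor
  · exact fun h => h.2
  · rintro ⟨h₁, h₂⟩
    exact ⟨by rw [h₁, h₂, hp], h₁, h₂⟩

end GraphCode

/-! ### A four-circulant code of length 72 -/

/-- The entries of the matrix `[[X, Y], [Yᵀ, Xᵀ]]`, where `X` and `Y` are the circulant
matrices of order 18 whose first rows are the binary digits of `0x9ca4` and `0x1ed7`. -/
def fourCirculant (i j : Fin 36) : Bool :=
  if i < 18 then (if j < 18 then 0x9ca4 else 0x1ed7).testBit ((j + 36 - i : ℕ) % 18)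
  else (if j < 18 then 0x1ed7 else 0x9ca4).testBit ((i + 36 - j : ℕ) % 18)

theorem fourCirculant_mul_transpose :
    bitMatrix fourCirculant * (bitMatrix fourCirculant).transpose = 1 := by
  decide +kernel

/-- The number of codewords with weights `k` and `l` on the two halves, for `k ≤ 7` and
`k + l ≤ 14`. -/
def lowLeftCount : ℕ → ℕ → ℕ
  | 0, 0 => 1
  | 3, 11 => 180
  | 4, 8 => 144
  | 5, 9 => 2160
  | 6, 6 => 162
  | 7, 7 => 3816
  | _, _ => 0

/-- The number of codewords with weights `l` and `k` on the two halves, for `k ≤ 6` and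
`k + l ≤ 14`. -/
def lowRightCount : ℕ → ℕ → ℕ
  | 0, 0 => 1
  | 2, 10 => 18
  | 3, 11 => 72
  | 4, 8 => 198
  | 5, 9 => 1260
  | 6, 6 => 162
  | _, _ => 0

theorem weightCounts_fourCirculant : ∀ k < 8,
    weightCounts fourCirculant 23 6 k (15 - k) = (List.range (15 - k)).map (lowLeftCount k) := by
  decide +kernel

theorem weightCounts_fourCirculant_transpose : ∀ k < 7,
    weightCounts (fun i j => fourCirculant j i) 21 6 k (15 - k) =
      (List.range (15 - k)).map (lowRightCount k) := by
  decide +kernel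

theorem splitCount_eq_of_weightCounts_eq {n : ℕ} {B : Fin n → Fin n → Bool} {d m k l : ℕ}
    {f : ℕ → ℕ} (h : weightCounts B d m k l = (List.range l).map f) (hd : n.choose k ≤ 2 ^ d)
    (hm : n < 2 ^ m) (hl : l ≤ 2 ^ m) {w : ℕ} (hw : w < l) :
    splitCount (bitMatrix B) k w = f w := by
  rw [weightCounts_eq B hd hm hl, List.map_inj_left] at h
  rw [splitCount_bitMatrix, h w (List.mem_range.2 hw)]

theorem splitCount_fourCirculant {k l : ℕ} (h : k + l ≤ 14) :
    splitCount (bitMatrix fourCirculant) k l =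
      if k ≤ 7 then lowLeftCount k l else lowRightCount l k := by
  split_ifs with hk
  · refine splitCount_eq_of_weightCounts_eq (weightCounts_fourCirculant k (by lia)) ?_
      (by norm_num) (by lia) (by lia)
    interval_cases k <;> decide +kernel
  · rw [splitCount_transpose fourCirculant_mul_transpose]
    refine splitCount_eq_of_weightCounts_eq (B := fun i j => fourCirculant j i)
      (weightCounts_fourCirculant_transpose l (by lia)) ?_ (by norm_num) (by lia) (by lia)
    have : l < 7 := by lia
    interval_cases l <;> decide +kernel

theorem card_fourCirculant_hamWt {w : ℕ} (hw : w ≤ 14) :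
    Nat.card {v : Fin 72 → ZMod 2 //
      v ∈ graphCode (bitMatrix fourCirculant) ∧ hamWt v = w} =
      ∑ p ∈ Finset.HasAntidiagonal.antidiagonal w,
        if p.1 ≤ 7 then lowLeftCount p.1 p.2 else lowRightCount p.2 p.1 := by
  refine (card_graphCode_hamWt (bitMatrix fourCirculant) w).trans (Finset.sum_congr rfl fun p hp => ?_)
  exact splitCount_fourCirculant ((Finset.HasAntidiagonal.mem_antidiagonal.1 hp).trans_le hw)

/-- There is a self-dual binary linear code of length 72 with minimum nonzero Hamming
weight 12, having exactly 522 codewords of weight 12 and exactly 7488 codewords of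
weight 14 (weight enumerator `W_{72,1}` with γ = 18 and β = 261). -/
theorem exists_selfDual_code_72_gamma_18_beta_261 :
    ∃ C : Submodule (ZMod 2) (Fin 72 → ZMod 2),
      IsSelfDual C ∧
      IsLeast {k | ∃ v ∈ C, v ≠ 0 ∧ hamWt v = k} 12 ∧
      Nat.card {v : Fin 72 → ZMod 2 // v ∈ C ∧ hamWt v = 12} = 522 ∧
      Nat.card {v : Fin 72 → ZMod 2 // v ∈ C ∧ hamWt v = 14} = 7488 := by
  have h₁₂ := card_fourCirculant_hamWt (w := 12) (by lia)
  have h₁₄ := card_fourCirculant_hamWt (w := 14) (by lia)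
  refine ⟨graphCode (bitMatrix fourCirculant), isSelfDual_graphCode fourCirculant_mul_transpose,
    ⟨?_, ?_⟩, h₁₂.trans (by decide +kernel), h₁₄.trans (by decide +kernel)⟩
  · have hne : Nat.card {v : Fin 72 → ZMod 2 //
        v ∈ graphCode (bitMatrix fourCirculant) ∧ hamWt v = 12} ≠ 0 := by
      rw [h₁₂]
      decide +kernel
    obtain ⟨⟨⟨v, hv, hw⟩⟩, -⟩ := Nat.card_ne_zero.1 hne
    refine ⟨v, hv, ?_, hw⟩
    rintro rfl
    simp [hamWt] at hw
  · rintro k ⟨v, hv, hv₀, rfl⟩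
    by_contra! hlt
    have hpos : 0 < hamWt v := by
      obtain ⟨i, hi⟩ := Function.ne_iff.1 hv₀
      exact Finset.card_pos.2 ⟨i, Finset.mem_filter_univ i |>.2 hi⟩
    have hzero : ∀ w < 12, 0 < w → ∑ p ∈ Finset.HasAntidiagonal.antidiagonal w,
        (if p.1 ≤ 7 then lowLeftCount p.1 p.2 else lowRightCount p.2 p.1) = 0 := by
      decide +kernel
    have hcard := (card_fourCirculant_hamWt (w := hamWt v) (by lia)).trans (hzero _ hlt hpos)
    have : Nonempty {u : Fin 72 → ZMod 2 //
        u ∈ graphCode (bitMatrix fourCirculant) ∧ hamWt u = hamWt v} := ⟨⟨v, hv, rfl⟩⟩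
    exact Nat.card_pos.ne' hcard
end
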